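/- arXiv:2312.10969 — 2 statements merged into one kernel-verified Lean document; each statement's English description precedes it below -/
import Mathlib

section
/- Let N ≥ 1 be an integer and 0 < θ < 2, and set H(x,t) := min(t^{−N/θ}, t·|x|^{−(N+θ)}) for x ∈ ℝ^N and t > 0. Then there exists a constant C₁ > 0, depending only on N and θ, such that ∫_{ℝ^N} H(x−y,t) dm₁(y) ≤ C₁ t^{−N/θ} sup_{z ∈ ℝ^N} m₁(B(z, t^{1/θ})) for every nonnegative Radon measure m₁ on ℝ^N and every (x,t) ∈ ℝ^N × (0,∞). -/
open MeasureTheory Set Metric ENNReal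
open scoped Classical

noncomputable section

namespace FracSHE

abbrev Rn (N : ℕ) := EuclideanSpace ℝ (Fin N)

/-- Distance to the boundary of `Ω`. -/
def dd {N : ℕ} (Ω : Set (Rn N)) (x : Rn N) : ℝ := Metric.infDist x (frontier Ω)

/-- `D(x,t) = d(x)^{θ/2}/(d(x)^{θ/2}+√t)`. -/
def DD {N : ℕ} (θ : ℝ) (Ω : Set (Rn N)) (x : Rn N) (t : ℝ) : ℝ :=
  dd Ω x ^ (θ / 2) / (dd Ω x ^ (θ / 2) + Real.sqrt t)

/-- `B_Ω(z,r) = B(z,r) ∩ closure Ω`. -/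
def BO {N : ℕ} (Ω : Set (Rn N)) (z : Rn N) (r : ℝ) : Set (Rn N) :=
  Metric.ball z r ∩ closure Ω

/-- The comparison kernel `H(x,t) = min(t^{-N/θ}, t·|x|^{-(N+θ)})` for the fractional
heat kernel `Γ_θ` (one has `Γ_θ ≍ H`). -/
def Hker (N : ℕ) (θ : ℝ) (x : Rn N) (t : ℝ) : ℝ :=
  min (t ^ (-(N : ℝ) / θ)) (t * ‖x‖ ^ (-((N : ℝ) + θ)))

/-- `Φ(x,y,t) = min(1, d(x)^{θ/2}/√t) · min(1, d(y)^{θ/2}/√t) · H(x-y,t)`. -/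
def PhiG {N : ℕ} (θ : ℝ) (Ω : Set (Rn N)) (x y : Rn N) (t : ℝ) : ℝ :=
  min 1 (dd Ω x ^ (θ / 2) / Real.sqrt t) * min 1 (dd Ω y ^ (θ / 2) / Real.sqrt t) *
    Hker N θ (x - y) t

/-- `Ψ₀(x,y,t) = min(1, d(x)^{θ/2}/√t) · min(d(y)^{-θ/2}, t^{-1/2}) · H(x-y,t)`;
the middle factor is written as `(max(d(y)^{θ/2}, √t))⁻¹` so that it equals `t^{-1/2}`
also on the boundary (where `d(y) = 0`). -/
def Psi0 {N : ℕ} (θ : ℝ) (Ω : Set (Rn N)) (x y : Rn N) (t : ℝ) : ℝ :=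
  min 1 (dd Ω x ^ (θ / 2) / Real.sqrt t) * (max (dd Ω y ^ (θ / 2)) (Real.sqrt t))⁻¹ *
    Hker N θ (x - y) t

/-- `T_* = min(T', diam(Ω)^θ/16)`, computed in `ℝ≥0∞` (an unbounded `Ω` has infinite
diameter). -/
def TStar {N : ℕ} (θ : ℝ) (Ω : Set (Rn N)) (T' : ℝ) : ℝ≥0∞ :=
  min (ENNReal.ofReal T') (EMetric.diam Ω ^ θ / 16)

/-- The Fujita-type exponent `p_θ(d,l) = 1 + θ/(d+l)`. -/
def pF (θ d l : ℝ) : ℝ := 1 + θ / (d + l)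

/-- The set of times `{t : ℝ | 0 < t < T}`, for `T : ℝ≥0∞`. -/
def timeSet (T : ℝ≥0∞) : Set ℝ := {t : ℝ | 0 < t ∧ ENNReal.ofReal t < T}

/-- The right-hand side of the Duhamel formulation of (SHE). -/
def solRHS {N : ℕ} (Ω : Set (Rn N)) (p : ℝ) (G K : Rn N → Rn N → ℝ → ℝ)
    (μ : Measure (Rn N)) (u : Rn N → ℝ → ℝ) (x : Rn N) (t : ℝ) : ℝ≥0∞ :=
  (∫⁻ y, ENNReal.ofReal (K x y t) ∂μ) +
    ∫⁻ s in Set.Ioo (0 : ℝ) t, ∫⁻ y in Ω, ENNReal.ofReal (G x y (t - s) * u y s ^ p)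

/-- The (product) measure on `Q_T = Ω × (0,T)`. -/
def QTmeasure {N : ℕ} (Ω : Set (Rn N)) (T : ℝ≥0∞) : Measure (Rn N × ℝ) :=
  (volume.restrict Ω).prod (volume.restrict (timeSet T))

/-- `u` is a solution of problem (SHE) with initial data `μ` in `Q_T`. -/
def IsSolutionSHE {N : ℕ} (Ω : Set (Rn N)) (p : ℝ) (G K : Rn N → Rn N → ℝ → ℝ)
    (μ : Measure (Rn N)) (T : ℝ≥0∞) (u : Rn N → ℝ → ℝ) : Prop :=
  Measurable (Function.uncurry u) ∧ (∀ x t, 0 ≤ u x t) ∧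
    ∀ᵐ q ∂(QTmeasure Ω T),
      ENNReal.ofReal (u q.1 q.2) = solRHS Ω p G K μ u q.1 q.2

/-- `u` is a supersolution of problem (SHE) with initial data `μ` in `Q_T`. -/
def IsSuperSolutionSHE {N : ℕ} (Ω : Set (Rn N)) (p : ℝ) (G K : Rn N → Rn N → ℝ → ℝ)
    (μ : Measure (Rn N)) (T : ℝ≥0∞) (u : Rn N → ℝ → ℝ) : Prop :=
  Measurable (Function.uncurry u) ∧ (∀ x t, 0 ≤ u x t) ∧
    ∀ᵐ q ∂(QTmeasure Ω T),
      solRHS Ω p G K μ u q.1 q.2 ≤ ENNReal.ofReal (u q.1 q.2)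

/-- The hypotheses on the Dirichlet heat kernel `G` and the associated kernel `K`. -/
structure KernelHyp (N : ℕ) (θ : ℝ) (Ω : Set (Rn N)) (G K : Rn N → Rn N → ℝ → ℝ)
    (T' c₁ c₂ c₃ c₄ : ℝ) : Prop where
  T'_pos : 0 < T'
  c₁_pos : 0 < c₁
  c₁_le_c₂ : c₁ ≤ c₂
  c₃_pos : 0 < c₃
  c₃_le_c₄ : c₃ ≤ c₄
  G_nonneg : ∀ x y t, 0 ≤ G x y t
  K_nonneg : ∀ x y t, 0 ≤ K x y t
  G_contOn : ContinuousOn (fun q : Rn N × Rn N × ℝ => G q.1 q.2.1 q.2.2)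
    (closure Ω ×ˢ closure Ω ×ˢ Set.Ioi (0 : ℝ))
  K_contOn : ContinuousOn (fun q : Rn N × Rn N × ℝ => K q.1 q.2.1 q.2.2)
    (closure Ω ×ˢ closure Ω ×ˢ Set.Ioi (0 : ℝ))
  G_symm : ∀ x y t, G x y t = G y x t
  G_pos : ∀ x ∈ Ω, ∀ y ∈ Ω, ∀ t : ℝ, 0 < t → 0 < G x y t
  G_mass_le_one : ∀ x ∈ Ω, ∀ t : ℝ, 0 < t →
    (∫⁻ y in Ω, ENNReal.ofReal (G x y t)) ≤ 1
  G_semigroup : ∀ x ∈ Ω, ∀ y ∈ Ω, ∀ s t : ℝ, 0 < s → 0 < t →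
    (∫⁻ z in Ω, ENNReal.ofReal (G x z t * G z y s)) = ENNReal.ofReal (G x y (t + s))
  G_lower : ∀ x ∈ closure Ω, ∀ y ∈ closure Ω, ∀ t : ℝ, 0 < t → t ≤ T' →
    c₁ * PhiG θ Ω x y t ≤ G x y t
  G_upper : ∀ x ∈ closure Ω, ∀ y ∈ closure Ω, ∀ t : ℝ, 0 < t → t ≤ T' →
    G x y t ≤ c₂ * PhiG θ Ω x y t
  K_eq : ∀ x ∈ closure Ω, ∀ y ∈ Ω, ∀ t : ℝ, 0 < t →
    K x y t = G x y t / dd Ω y ^ (θ / 2)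
  K_bdry : ∀ x ∈ frontier Ω, ∀ (y : Rn N) (t : ℝ), 0 < t → K x y t = 0
  GK_semigroup : ∀ z ∈ Ω, ∀ y ∈ closure Ω, ∀ s t : ℝ, 0 < s → 0 < t →
    (∫⁻ x in Ω, ENNReal.ofReal (G z x s * K x y t)) = ENNReal.ofReal (K z y (t + s))
  K_lower : ∀ x ∈ closure Ω, ∀ y ∈ closure Ω, ∀ t : ℝ, 0 < t → t ≤ T' →
    c₃ * Psi0 θ Ω x y t ≤ K x y t
  K_upper : ∀ x ∈ closure Ω, ∀ y ∈ closure Ω, ∀ t : ℝ, 0 < t → t ≤ T' →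
    K x y t ≤ c₄ * Psi0 θ Ω x y t

/-- The surface measure on `∂Ω`: the `(N-1)`-dimensional Hausdorff measure restricted to
the boundary. -/
def surf (N : ℕ) (Ω : Set (Rn N)) : Measure (Rn N) :=
  (μH[(N : ℝ) - 1]).restrict (frontier Ω)

/-- `[𝖦(t)F](x) = ∫_Ω G(x,y,t) F(y) dy`. -/
def Gop {N : ℕ} (Ω : Set (Rn N)) (G : Rn N → Rn N → ℝ → ℝ) (F : Rn N → ℝ)
    (t : ℝ) (x : Rn N) : ℝ :=
  ∫ y in Ω, G x y t * F y

/-- `[𝖪(t)F](x) = (C₅ t^{1/2+1/θ}/D(x,t)) ∫_{∂Ω} K(x,y,t) F(y) dσ(y)`. -/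
def Kop {N : ℕ} (Ω : Set (Rn N)) (K : Rn N → Rn N → ℝ → ℝ) (θ C₅ : ℝ) (F : Rn N → ℝ)
    (t : ℝ) (x : Rn N) : ℝ :=
  C₅ * t ^ ((1 : ℝ) / 2 + 1 / θ) / DD θ Ω x t * ∫ y, K x y t * F y ∂(surf N Ω)

/-- The `L^∞(Ω)` "norm" of a (nonnegative) function, as the essential supremum in `ℝ≥0∞`. -/
def LinfO {N : ℕ} (Ω : Set (Rn N)) (F : Rn N → ℝ) : ℝ≥0∞ :=
  essSup (fun x => ENNReal.ofReal (F x)) (volume.restrict Ω)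

/-- `Φ(τ) = τ (log(e+τ))^r`. -/
def PhiLog (r τ : ℝ) : ℝ := τ * Real.log (Real.exp 1 + τ) ^ r

/-- The inverse of `Φ` on `[0,∞)`. -/
def PhiLogInv (r : ℝ) : ℝ → ℝ := Function.invFunOn (PhiLog r) (Set.Ici 0)

/-- The interior test profile `φ_z`. -/
def phiInt (N : ℕ) (θ p : ℝ) (Ω : Set (Rn N)) (z x : Rn N) : ℝ :=
  if p = pF θ N 0 then
    (if x ∈ BO Ω z (1 / 2) then
      ‖x - z‖ ^ (-(N : ℝ)) * |Real.log ‖x - z‖| ^ (-(N : ℝ) / θ - 1) else 0)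
  else
    (if x ∈ BO Ω z 1 then ‖x - z‖ ^ (-(θ / (p - 1))) else 0)

/-- The boundary test profile `ψ_z`. -/
def psiBdy (N : ℕ) (θ p : ℝ) (Ω : Set (Rn N)) (z x : Rn N) : ℝ :=
  if p = pF θ N (θ / 2) then
    (if x ∈ BO Ω z (1 / 2) then
      ‖x - z‖ ^ (-(N : ℝ) - θ / 2) *
        |Real.log ‖x - z‖| ^ (-((2 * N + θ) / (2 * θ)) - 1) else 0)
  else
    (if x ∈ BO Ω z 1 then ‖x - z‖ ^ (-(θ / (p - 1))) else 0)


/-- Change of variables `w = (x - z) / r` in a Lebesgue integral over `ℝ^N`. -/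
lemma lintegral_comp_inv_smul_sub {N : ℕ} {f : Rn N → ℝ≥0∞} (hf : Measurable f) (x : Rn N)
    {r : ℝ} (hr : 0 < r) :
    ∫⁻ z, f (r⁻¹ • (x - z)) = ENNReal.ofReal (r ^ N) * ∫⁻ w, f w := by
  rw [lintegral_sub_left_eq_self (fun w => f (r⁻¹ • w)) x,
    ← lintegral_map hf (measurable_const_smul r⁻¹),
    Measure.map_addHaar_smul volume (inv_ne_zero hr.ne'), lintegral_smul_measure]
  simp [abs_of_pos hr]

/-- The profile `(1 + ‖x - y‖ / r)^{-s}` is comparable to itself at points within distance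
`r` of each other. -/
lemma one_add_norm_rpow_neg_le {N : ℕ} {s : ℝ} (hs : 0 ≤ s) {r : ℝ} (hr : 0 < r)
    {x y z : Rn N} (hz : dist z y < r) :
    (1 + ‖r⁻¹ • (x - y)‖) ^ (-s) ≤ 2 ^ s * (1 + ‖r⁻¹ • (x - z)‖) ^ (-s) := by
  have h1 : ‖r⁻¹ • (y - z)‖ ≤ 1 := by
    rw [norm_smul, norm_inv, Real.norm_of_nonneg hr.le, ← dist_eq_norm, dist_comm,
      inv_mul_le_iff₀ hr]
    linarith
  have h2 : ‖r⁻¹ • (x - z)‖ ≤ ‖r⁻¹ • (x - y)‖ + ‖r⁻¹ • (y - z)‖ := by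
    refine le_trans (le_of_eq ?_) (norm_add_le _ _)
    rw [← smul_add, sub_add_sub_cancel]
  have h0 := norm_nonneg (r⁻¹ • (x - y))
  have h3 : (1 + ‖r⁻¹ • (x - z)‖) / 2 ≤ 1 + ‖r⁻¹ • (x - y)‖ := by linarith
  calc (1 + ‖r⁻¹ • (x - y)‖) ^ (-s) ≤ ((1 + ‖r⁻¹ • (x - z)‖) / 2) ^ (-s) :=
        Real.rpow_le_rpow_of_nonpos (by positivity) h3 (by linarith)
    _ = 2 ^ s * (1 + ‖r⁻¹ • (x - z)‖) ^ (-s) := by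
        rw [Real.div_rpow (by positivity) (by norm_num), Real.rpow_neg zero_le_two, div_inv_eq_mul,
          mul_comm]

/-- `H` is dominated by a rescaled Japanese bracket. -/
lemma Hker_le {N : ℕ} {θ : ℝ} (hθ : 0 < θ) (w : Rn N) {t : ℝ} (ht : 0 < t) :
    Hker N θ w t ≤ t ^ (-(N : ℝ) / θ) *
      (2 ^ ((N : ℝ) + θ) * (1 + ‖(t ^ (1 / θ))⁻¹ • w‖) ^ (-((N : ℝ) + θ))) := by
  set r := t ^ (1 / θ) with hr_def
  have hr : 0 < r := Real.rpow_pos_of_pos ht _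
  have hs : 0 < (N : ℝ) + θ := by positivity
  set u := ‖r⁻¹ • w‖ with hu_def
  have hu0 : 0 ≤ u := norm_nonneg _
  have hwu : ‖w‖ = r * u := by
    rw [hu_def, norm_smul, norm_inv, Real.norm_of_nonneg hr.le, mul_inv_cancel_left₀ hr.ne']
  have hK : (2 : ℝ) ^ ((N : ℝ) + θ) * (1 + u) ^ (-((N : ℝ) + θ))
      = ((1 + u) / 2) ^ (-((N : ℝ) + θ)) := by
    rw [Real.div_rpow (by positivity) (by norm_num), Real.rpow_neg zero_le_two, div_inv_eq_mul,
      mul_comm]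
  rw [hK]
  have hT : 0 ≤ t ^ (-(N : ℝ) / θ) := by positivity
  rcases le_total u 1 with h | h
  · refine (min_le_left _ _).trans (le_mul_of_one_le_right hT ?_)
    exact Real.one_le_rpow_of_pos_of_le_one_of_nonpos (by positivity) (by linarith) (by linarith)
  · refine (min_le_right _ _).trans ?_
    have hscale : t * r ^ (-((N : ℝ) + θ)) = t ^ (-(N : ℝ) / θ) := by
      rw [hr_def, ← Real.rpow_mul ht.le]
      nth_rewrite 1 [← Real.rpow_one t]
      rw [← Real.rpow_add ht]
      congr 1
      field_simp
      ring
    rw [hwu, Real.mul_rpow hr.le hu0, ← mul_assoc, hscale]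
    exact mul_le_mul_of_nonneg_left
      (Real.rpow_le_rpow_of_nonpos (by positivity) (by linarith) (by linarith)) hT

/-- If `f ≤ K * f(z)` on each ball `B(y,r)`, then averaging over balls bounds the
integral of `f` against a measure by its Lebesgue integral and the largest mass of a ball. -/
lemma volume_ball_mul_lintegral_le {N : ℕ} (m : Measure (Rn N)) [SFinite m] {f : Rn N → ℝ≥0∞}
    (hf : Measurable f) {K : ℝ≥0∞} {r : ℝ}
    (hK : ∀ y z, dist z y < r → f y ≤ K * f z) :
    volume (ball (0 : Rn N) r) * ∫⁻ y, f y ∂m ≤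
      K * ((∫⁻ z, f z) * ⨆ z, m (ball z r)) := by
  have hS : MeasurableSet {p : Rn N × Rn N | dist p.2 p.1 < r} :=
    (isOpen_lt (by fun_prop) continuous_const).measurableSet
  have hg : Measurable (fun p : Rn N × Rn N =>
      {p : Rn N × Rn N | dist p.2 p.1 < r}.indicator (fun p => K * f p.2) p) :=
    Measurable.indicator (by fun_prop) hS
  calc volume (ball (0 : Rn N) r) * ∫⁻ y, f y ∂m
      = ∫⁻ y, volume (ball (0 : Rn N) r) * f y ∂m := (lintegral_const_mul _ hf).symm
    _ ≤ ∫⁻ y, (∫⁻ z, {p : Rn N × Rn N | dist p.2 p.1 < r}.indicator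
          (fun p => K * f p.2) (y, z)) ∂m := by
        refine lintegral_mono fun y => ?_
        rw [← Measure.addHaar_ball_center volume y r, mul_comm, ← setLIntegral_const,
          ← lintegral_indicator measurableSet_ball]
        refine lintegral_mono fun z => ?_
        by_cases h : dist z y < r
        · rw [indicator_of_mem (mem_ball.2 h), indicator_of_mem (by exact h)]
          exact hK y z h
        · rw [indicator_of_notMem (by simpa using h)]
          exact zero_le
    _ = ∫⁻ z, ∫⁻ y, {p : Rn N × Rn N | dist p.2 p.1 < r}.indicator
          (fun p => K * f p.2) (y, z) ∂m := lintegral_lintegral_swap hg.aemeasurable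
    _ = ∫⁻ z, K * (f z * m (ball z r)) := by
        refine lintegral_congr fun z => ?_
        rw [← mul_assoc, ← setLIntegral_const, ← lintegral_indicator measurableSet_ball]
        refine lintegral_congr fun y => ?_
        simp only [indicator, mem_ofPred_eq, mem_ball, dist_comm]
    _ ≤ ∫⁻ z, (K * ⨆ z, m (ball z r)) * f z := by
        refine lintegral_mono fun z => ?_
        rw [mul_assoc, mul_comm (f z)]
        gcongr
        exact le_iSup (fun z => m (ball z r)) z
    _ = K * ((∫⁻ z, f z) * ⨆ z, m (ball z r)) := by
        rw [lintegral_const_mul _ hf, mul_assoc, mul_comm (∫⁻ z, f z)]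

/-- the convolution bound for the comparison kernel `H`. -/
theorem statement14 (N : ℕ) (hN : 1 ≤ N) (θ : ℝ) (hθ0 : 0 < θ) (hθ2 : θ < 2) :
    ∃ C₁ : ℝ, 0 < C₁ ∧
      ∀ (m₁ : Measure (Rn N)), IsLocallyFiniteMeasure m₁ →
        ∀ (x : Rn N) (t : ℝ), 0 < t →
          (∫⁻ y, ENNReal.ofReal (Hker N θ (x - y) t) ∂m₁) ≤
            ENNReal.ofReal (C₁ * t ^ (-(N : ℝ) / θ)) *
              ⨆ z : Rn N, m₁ (Metric.ball z (t ^ (1 / θ))) := by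
  set s : ℝ := (N : ℝ) + θ with hs_def
  have hs : 0 < s := by positivity
  set I : ℝ≥0∞ := ∫⁻ w : Rn N, ENNReal.ofReal ((1 + ‖w‖) ^ (-s)) with hI_def
  have hI : I ≠ ∞ := (finite_integral_one_add_norm (by simp [hs_def, hθ0])).ne
  set V : ℝ≥0∞ := volume (ball (0 : Rn N) 1) with hV_def
  have hV0 : V ≠ 0 := (measure_ball_pos _ _ one_pos).ne'
  have hV : V ≠ ∞ := measure_ball_lt_top.ne
  set K : ℝ≥0∞ := ENNReal.ofReal (2 ^ s) with hK_def
  have hA : K * (V⁻¹ * (K * I)) ≠ ∞ := by finiteness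
  refine ⟨(K * (V⁻¹ * (K * I))).toReal + 1, by positivity, fun m₁ _ x t ht => ?_⟩
  set r := t ^ (1 / θ) with hr_def
  have hr : 0 < r := Real.rpow_pos_of_pos ht _
  set M := ⨆ z : Rn N, m₁ (ball z r)
  set T := t ^ (-(N : ℝ) / θ)
  have hT : 0 ≤ T := by positivity
  let f : Rn N → ℝ≥0∞ := fun y => ENNReal.ofReal ((1 + ‖r⁻¹ • (x - y)‖) ^ (-s))
  have hf : Measurable f := by fun_prop
  have hint : ∫⁻ z, f z = ENNReal.ofReal (r ^ N) * I :=
    lintegral_comp_inv_smul_sub (f := fun w => ENNReal.ofReal ((1 + ‖w‖) ^ (-s)))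
      (by fun_prop) x hr
  have hball : volume (ball (0 : Rn N) r) = ENNReal.ofReal (r ^ N) * V := by
    rw [Measure.addHaar_ball_of_pos volume _ hr, finrank_euclideanSpace_fin]
  have hR0 : ENNReal.ofReal (r ^ N) ≠ 0 := by simpa using pow_pos hr N
  have havg : ∫⁻ y, f y ∂m₁ ≤ V⁻¹ * (K * I) * M := by
    have h := volume_ball_mul_lintegral_le m₁ hf (K := K) (r := r) fun y z hz => by
      rw [hK_def, ← ENNReal.ofReal_mul (by positivity)]
      exact ENNReal.ofReal_le_ofReal (one_add_norm_rpow_neg_le hs.le hr hz)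
    rw [hball, hint, mul_assoc, show K * (ENNReal.ofReal (r ^ N) * I * M) =
      ENNReal.ofReal (r ^ N) * (K * I * M) by ring,
      ENNReal.mul_le_mul_iff_right hR0 ENNReal.ofReal_ne_top] at h
    rwa [mul_assoc, ← ENNReal.mul_le_iff_le_inv hV0 hV]
  calc ∫⁻ y, ENNReal.ofReal (Hker N θ (x - y) t) ∂m₁
      ≤ ∫⁻ y, ENNReal.ofReal T * K * f y ∂m₁ := by
        refine lintegral_mono fun y => ?_
        rw [hK_def, mul_assoc, ← ENNReal.ofReal_mul (by positivity), ← ENNReal.ofReal_mul hT]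
        exact ENNReal.ofReal_le_ofReal (Hker_le hθ0 (x - y) ht)
    _ = ENNReal.ofReal T * K * ∫⁻ y, f y ∂m₁ := lintegral_const_mul _ hf
    _ ≤ ENNReal.ofReal T * K * (V⁻¹ * (K * I) * M) := by gcongr
    _ = K * (V⁻¹ * (K * I)) * ENNReal.ofReal T * M := by ring
    _ ≤ ENNReal.ofReal (((K * (V⁻¹ * (K * I))).toReal + 1) * T) * M := by
        rw [ENNReal.ofReal_mul (by positivity)]
        gcongr
        rw [← ENNReal.ofReal_toReal hA]
        exact ENNReal.ofReal_le_ofReal (by simp)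

end FracSHE
end
end

section
/- Assume that there exists a supersolution v of problem (SHE) with initial data the nonnegative Radon measure μ in Q_T, where 0 < T ≤ ∞. Then problem (SHE) with initial data μ possesses a solution u in Q_T such that u(x,t) ≤ v(x,t) for almost all (x,t) ∈ Q_T. -/
open MeasureTheory Set Metric ENNReal
open scoped Classical

noncomputable section

namespace FracSHE

/-- The Duhamel operator of (SHE), acting on functions with values in `ℝ≥0∞`. -/
def duhamel {N : ℕ} (Ω : Set (Rn N)) (p : ℝ) (G K : Rn N → Rn N → ℝ → ℝ)
    (μ : Measure (Rn N)) (w : Rn N × ℝ → ℝ≥0∞) (q : Rn N × ℝ) : ℝ≥0∞ :=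
  (∫⁻ y, ENNReal.ofReal (K q.1 y q.2) ∂μ) +
    ∫⁻ s in Set.Ioo (0 : ℝ) q.2, ∫⁻ y in Ω, ENNReal.ofReal (G q.1 y (q.2 - s)) * w (y, s) ^ p

section Duhamel

variable {N : ℕ} {Ω : Set (Rn N)} {p : ℝ} {G K : Rn N → Rn N → ℝ → ℝ} {μ : Measure (Rn N)}

theorem solRHS_eq_duhamel (hp : 0 ≤ p) (hG : ∀ x y t, 0 ≤ G x y t) {u : Rn N → ℝ → ℝ}
    (hu : ∀ x t, 0 ≤ u x t) (x : Rn N) (t : ℝ) :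
    solRHS Ω p G K μ u x t = duhamel Ω p G K μ (fun q => ENNReal.ofReal (u q.1 q.2)) (x, t) := by
  simp only [solRHS, duhamel, ENNReal.ofReal_mul (hG _ _ _),
    ENNReal.ofReal_rpow_of_nonneg (hu _ _) hp]

theorem duhamel_mono (hp : 0 ≤ p) : Monotone (duhamel Ω p G K μ) := by
  intro w₁ w₂ h q
  unfold duhamel
  gcongr
  exact h _

theorem measurable_timeSet (T : ℝ≥0∞) : MeasurableSet (timeSet T) :=
  measurableSet_Ioi.inter (measurableSet_lt ENNReal.measurable_ofReal measurable_const)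

theorem ae_mem_timeSet (Ω : Set (Rn N)) (T : ℝ≥0∞) :
    ∀ᵐ q ∂(QTmeasure Ω T), q.2 ∈ timeSet T :=
  Measure.quasiMeasurePreserving_snd.ae (ae_restrict_mem (measurable_timeSet T))

/-- On `Q_T`, the Duhamel operator only sees the values of its argument a.e. in `Q_T`. -/
theorem duhamel_le_of_ae_le (hp : 0 ≤ p) {T : ℝ≥0∞} {w₁ w₂ : Rn N × ℝ → ℝ≥0∞}
    (h : ∀ᵐ q ∂(QTmeasure Ω T), w₁ q ≤ w₂ q) {q : Rn N × ℝ} (hq : q.2 ∈ timeSet T) :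
    duhamel Ω p G K μ w₁ q ≤ duhamel Ω p G K μ w₂ q := by
  have hswap : ∀ᵐ r ∂((volume.restrict (timeSet T)).prod (volume.restrict Ω)),
      w₁ r.swap ≤ w₂ r.swap :=
    Measure.measurePreserving_swap.quasiMeasurePreserving.ae h
  have hsub : Set.Ioo 0 q.2 ⊆ timeSet T := fun s hs =>
    ⟨hs.1, (ENNReal.ofReal_le_ofReal hs.2.le).trans_lt hq.2⟩
  have hae := ae_restrict_of_ae_restrict_of_subset hsub (Measure.ae_ae_of_ae_prod hswap)
  unfold duhamel
  gcongr 1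
  refine lintegral_mono_ae ?_
  filter_upwards [hae] with s hs
  refine lintegral_mono_ae ?_
  filter_upwards [hs] with y hy
  gcongr
  exact hy

theorem measurable_duhamel [SFinite μ]
    (hGm : Measurable fun q : Rn N × Rn N × ℝ => G q.1 q.2.1 q.2.2)
    (hKm : Measurable fun q : Rn N × Rn N × ℝ => K q.1 q.2.1 q.2.2)
    {w : Rn N × ℝ → ℝ≥0∞} (hw : Measurable w) : Measurable (duhamel Ω p G K μ w) := by
  refine Measurable.add ?_ ?_
  · have h : Measurable fun r : (Rn N × ℝ) × Rn N => ENNReal.ofReal (K r.1.1 r.2 r.1.2) :=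
      ENNReal.measurable_ofReal.comp (hKm.comp
        (f := fun r : (Rn N × ℝ) × Rn N => (r.1.1, r.2, r.1.2)) (by fun_prop))
    exact h.lintegral_prod_right'
  · have h : Measurable fun r : ((Rn N × ℝ) × ℝ) × Rn N =>
        ENNReal.ofReal (G r.1.1.1 r.2 (r.1.1.2 - r.1.2)) * w (r.2, r.1.2) ^ p :=
      (ENNReal.measurable_ofReal.comp (hGm.comp
        (f := fun r : ((Rn N × ℝ) × ℝ) × Rn N => (r.1.1.1, r.2, r.1.1.2 - r.1.2))
        (by fun_prop))).mul ((hw.comp (by fun_prop)).pow_const p)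
    have h' : Measurable fun r : (Rn N × ℝ) × ℝ =>
        ∫⁻ y in Ω, ENNReal.ofReal (G r.1.1 y (r.1.2 - r.2)) * w (y, r.2) ^ p :=
      h.lintegral_prod_right'
    have hS : MeasurableSet {r : (Rn N × ℝ) × ℝ | r.2 ∈ Set.Ioo 0 r.1.2} :=
      (measurableSet_lt measurable_const measurable_snd).inter
        (measurableSet_lt measurable_snd (by fun_prop))
    convert (h'.indicator hS).lintegral_prod_right' (ν := volume) using 2 with q
    rw [← lintegral_indicator measurableSet_Ioo]
    rfl

theorem duhamel_iSup (hp : 0 < p)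
    (hGm : Measurable fun q : Rn N × Rn N × ℝ => G q.1 q.2.1 q.2.2)
    {w : ℕ → Rn N × ℝ → ℝ≥0∞} (hw : ∀ n, Measurable (w n)) (hmono : Monotone w) :
    duhamel Ω p G K μ (⨆ n, w n) = ⨆ n, duhamel Ω p G K μ (w n) := by
  funext q
  have hpow (y : Rn N) (s : ℝ) : ENNReal.ofReal (G q.1 y (q.2 - s)) * (⨆ n, w n) (y, s) ^ p =
      ⨆ n, ENNReal.ofReal (G q.1 y (q.2 - s)) * w n (y, s) ^ p := by
    rw [iSup_apply, ← ENNReal.mul_iSup]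
    congr 1
    exact (ENNReal.orderIsoRpow p hp).map_iSup _
  have hm (n : ℕ) : Measurable fun r : ℝ × Rn N =>
      ENNReal.ofReal (G q.1 r.2 (q.2 - r.1)) * w n (r.2, r.1) ^ p :=
    (ENNReal.measurable_ofReal.comp (hGm.comp
      (f := fun r : ℝ × Rn N => (q.1, r.2, q.2 - r.1)) (by fun_prop))).mul
      (((hw n).comp measurable_swap).pow_const p)
  have hle {m n : ℕ} (hmn : m ≤ n) (y : Rn N) (s : ℝ) :
      ENNReal.ofReal (G q.1 y (q.2 - s)) * w m (y, s) ^ p ≤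
        ENNReal.ofReal (G q.1 y (q.2 - s)) * w n (y, s) ^ p := by
    gcongr
    exact hmono hmn _
  rw [iSup_apply]
  simp only [duhamel, hpow]
  rw [← ENNReal.add_iSup]
  congr 1
  rw [← lintegral_iSup (fun n => (hm n).lintegral_prod_right')
    (fun m n hmn s => lintegral_mono fun y => hle hmn y s)]
  refine lintegral_congr fun s => ?_
  exact lintegral_iSup (fun n => (hm n).comp measurable_prodMk_left)
    (fun m n hmn y => hle hmn y s)

/-- The Duhamel operator has a measurable fixed point lying a.e. below every `v` on `Q_T`
that dominates its own image. -/
theorem exists_duhamel_fixedPoint [SFinite μ] (hp : 0 < p)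
    (hGm : Measurable fun q : Rn N × Rn N × ℝ => G q.1 q.2.1 q.2.2)
    (hKm : Measurable fun q : Rn N × Rn N × ℝ => K q.1 q.2.1 q.2.2) :
    ∃ w : Rn N × ℝ → ℝ≥0∞, Measurable w ∧ duhamel Ω p G K μ w = w ∧
      ∀ (T : ℝ≥0∞) (v : Rn N × ℝ → ℝ≥0∞),
        (∀ᵐ q ∂(QTmeasure Ω T), duhamel Ω p G K μ v q ≤ v q) →
          ∀ᵐ q ∂(QTmeasure Ω T), w q ≤ v q := by
  set w : ℕ → Rn N × ℝ → ℝ≥0∞ := fun n => (duhamel Ω p G K μ)^[n] ⊥ with hw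
  have hsucc (n : ℕ) : w (n + 1) = duhamel Ω p G K μ (w n) :=
    Function.iterate_succ_apply' _ _ _
  have hmeas (n : ℕ) : Measurable (w n) := by
    induction n with
    | zero => exact measurable_const
    | succ n ih => rw [hsucc]; exact measurable_duhamel hGm hKm ih
  have hmono : Monotone w := (duhamel_mono hp.le).monotone_iterate_of_le_map bot_le
  refine ⟨⨆ n, w n, ?_, ?_, fun T v hv => ?_⟩
  · rw [show (⨆ n, w n) = fun q => ⨆ n, w n q from funext fun q => iSup_apply]
    exact Measurable.iSup hmeas
  · rw [duhamel_iSup hp hGm hmeas hmono]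
    simp only [← hsucc]
    exact hmono.iSup_nat_add 1
  · have hn (n : ℕ) : ∀ᵐ q ∂(QTmeasure Ω T), w n q ≤ v q := by
      induction n with
      | zero => exact Filter.Eventually.of_forall fun q => bot_le
      | succ n ih =>
        filter_upwards [hv, ae_mem_timeSet Ω T] with q hq hqT
        rw [hsucc]
        exact (duhamel_le_of_ae_le hp.le ih hqT).trans hq
    filter_upwards [ae_all_iff.2 hn] with q hq
    rw [iSup_apply]
    exact iSup_le hq

end Duhamel

/-- existence of a supersolution implies existence of a solution below it. -/
theorem statement17 (N : ℕ) (hN : 1 ≤ N) (θ : ℝ) (hθ0 : 0 < θ) (hθ2 : θ < 2)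
    (p : ℝ) (hp : 1 < p)
    (Ω : Set (Rn N)) (hΩ : IsOpen Ω) (hΩb : (frontier Ω).Nonempty)
    (G K : Rn N → Rn N → ℝ → ℝ)
    (hGm : Measurable fun q : Rn N × Rn N × ℝ => G q.1 q.2.1 q.2.2)
    (hKm : Measurable fun q : Rn N × Rn N × ℝ => K q.1 q.2.1 q.2.2)
    (hGnn : ∀ x y t, 0 ≤ G x y t) (hKnn : ∀ x y t, 0 ≤ K x y t)
    (μ : Measure (Rn N)) (hμloc : IsLocallyFiniteMeasure μ) (hμsupp : μ (closure Ω)ᶜ = 0)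
    (T : ℝ≥0∞) (hT : 0 < T)
    (v : Rn N → ℝ → ℝ) (hv : IsSuperSolutionSHE Ω p G K μ T v) :
    ∃ u, IsSolutionSHE Ω p G K μ T u ∧
      ∀ᵐ q ∂(QTmeasure Ω T), u q.1 q.2 ≤ v q.1 q.2 := by
  have hp0 : 0 < p := one_pos.trans hp
  obtain ⟨hvm, hvnn, hvle⟩ := hv
  obtain ⟨w, hwm, hfix, hmin⟩ :=
    exists_duhamel_fixedPoint (Ω := Ω) (μ := μ) hp0 hGm hKm
  have hwv : ∀ᵐ q ∂(QTmeasure Ω T), w q ≤ ENNReal.ofReal (v q.1 q.2) := by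
    refine hmin T (fun q => ENNReal.ofReal (v q.1 q.2)) ?_
    filter_upwards [hvle] with q hq
    rwa [solRHS_eq_duhamel hp0.le hGnn hvnn] at hq
  have hreal : ∀ᵐ q ∂(QTmeasure Ω T), ENNReal.ofReal (w (q.1, q.2)).toReal = w q := by
    filter_upwards [hwv] with q hq
    exact ENNReal.ofReal_toReal (hq.trans_lt ENNReal.ofReal_lt_top).ne
  refine ⟨fun x t => (w (x, t)).toReal, ⟨hwm.ennreal_toReal, fun _ _ => ENNReal.toReal_nonneg,
    ?_⟩, ?_⟩
  · filter_upwards [hreal, ae_mem_timeSet Ω T] with q hq hqT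
    rw [hq, solRHS_eq_duhamel hp0.le hGnn fun _ _ => ENNReal.toReal_nonneg]
    conv_lhs => rw [← hfix]
    exact le_antisymm (duhamel_le_of_ae_le hp0.le (hreal.mono fun _ h => h.ge) hqT)
      (duhamel_le_of_ae_le hp0.le (hreal.mono fun _ h => h.le) hqT)
  · filter_upwards [hwv] with q hq
    exact ENNReal.toReal_le_of_le_ofReal (hvnn _ _) hq

end FracSHE
end
end
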